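/- arXiv:1904.01055 — 4 statements merged into one kernel-verified Lean document; each statement's English description precedes it below -/
import Mathlib

section
/- Fix 0 < ε ≤ 1/2, an integer ℓ ≥ ε^{−20}, a vertex s of G, and set w = ℓ^{14}. Draw w independent samples from the distribution p_s^ℓ, let w_v be the number of samples equal to v, and let T = {v : w_v ≥ ℓ⁷/2}. Then with probability at least 1 − 2^{−1/ε}: (i) if ‖clip(p_s^ℓ, 1/4)‖₂² < ℓ^{−8}/400 then Σ_{v∈T} w_v < w/3; and (ii) if ‖clip(p_s^ℓ, 3/8)‖₂² > ℓ^{−7} then Σ_{v∈T} w_v ≥ w/3. -/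
open scoped Classical

noncomputable section

/-- Transition matrix of the lazy random walk on `G` with step probability `1/(2d)`. -/
def lazyStep {V : Type*} [Fintype V] [DecidableEq V] (G : SimpleGraph V) [DecidableRel G.Adj]
    (d : ℕ) : Matrix V V ℝ :=
  Matrix.of fun u v =>
    if G.Adj u v then 1 / (2 * d)
    else if u = v then 1 - (G.degree u : ℝ) / (2 * d)
    else 0

/-- `walkDist G d t s v` is the probability that the `t`-step lazy random walk from `s` ends
at `v`. -/
def walkDist {V : Type*} [Fintype V] [DecidableEq V] (G : SimpleGraph V) [DecidableRel G.Adj]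
    (d t : ℕ) (s : V) : V → ℝ :=
  fun v => (lazyStep G d ^ t) s v

/-- The squared `ξ`-clipped `ℓ₂`-norm of a nonnegative vector `x`: the least squared `ℓ₂`-norm
of a vector `y` with `0 ≤ y ≤ x` entrywise and `‖x - y‖₁ ≤ ξ`. -/
def clipNormSq {W : Type*} [Fintype W] (x : W → ℝ) (ξ : ℝ) : ℝ :=
  sInf { r : ℝ | ∃ y : W → ℝ, (∀ v, 0 ≤ y v ∧ y v ≤ x v) ∧ (∑ v, |x v - y v|) ≤ ξ ∧
    r = ∑ v, y v ^ 2 }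

theorem lazyStep_nonneg {V : Type*} [Fintype V] [DecidableEq V] (G : SimpleGraph V)
    [DecidableRel G.Adj] {d : ℕ} (hd : 1 ≤ d) (hdeg : ∀ v, G.degree v ≤ d) (u v : V) :
    0 ≤ lazyStep G d u v := by
  have hd' : (1 : ℝ) ≤ d := by exact_mod_cast hd
  have hu : (G.degree u : ℝ) ≤ d := by exact_mod_cast hdeg u
  simp only [lazyStep, Matrix.of_apply]
  split_ifs
  · positivity
  · rw [sub_nonneg, div_le_one (by positivity)]
    linarith
  · exact le_rfl

theorem lazyStep_row_sum {V : Type*} [Fintype V] [DecidableEq V] (G : SimpleGraph V)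
    [DecidableRel G.Adj] (d : ℕ) (u : V) : ∑ v, lazyStep G d u v = 1 := by
  have h : ∀ v, lazyStep G d u v = (if G.Adj u v then 1 / (2 * (d : ℝ)) else 0) +
      (if u = v then 1 - (G.degree u : ℝ) / (2 * d) else 0) := by
    intro v
    simp only [lazyStep, Matrix.of_apply]
    by_cases h1 : G.Adj u v
    · simp [h1, h1.ne]
    · simp [h1]
  simp_rw [h, Finset.sum_add_distrib]
  rw [Finset.sum_ite_eq, ← Finset.sum_filter, Finset.sum_const, ← G.neighborFinset_eq_filter,
    G.card_neighborFinset_eq_degree]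
  simp only [Finset.mem_univ, if_true, nsmul_eq_mul]
  ring

theorem walkDist_nonneg {V : Type*} [Fintype V] [DecidableEq V] (G : SimpleGraph V)
    [DecidableRel G.Adj] {d : ℕ} (hd : 1 ≤ d) (hdeg : ∀ v, G.degree v ≤ d) (t : ℕ) (s v : V) :
    0 ≤ walkDist G d t s v := by
  unfold walkDist
  induction t generalizing v with
  | zero => rw [pow_zero, Matrix.one_apply]; split_ifs <;> norm_num
  | succ t ih =>
    rw [pow_succ, Matrix.mul_apply]
    exact Finset.sum_nonneg fun u _ => mul_nonneg (ih u) (lazyStep_nonneg G hd hdeg u v)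

theorem walkDist_sum {V : Type*} [Fintype V] [DecidableEq V] (G : SimpleGraph V)
    [DecidableRel G.Adj] (d t : ℕ) (s : V) : ∑ v, walkDist G d t s v = 1 := by
  unfold walkDist
  induction t with
  | zero => simp [Matrix.one_apply]
  | succ t ih =>
    simp_rw [pow_succ, Matrix.mul_apply]
    rw [Finset.sum_comm]
    simp_rw [← Finset.mul_sum, lazyStep_row_sum, mul_one]
    exact ih

theorem clipNormSq_le {W : Type*} [Fintype W] {x y : W → ℝ} {ξ : ℝ}
    (hy : ∀ v, 0 ≤ y v ∧ y v ≤ x v) (hξ : ∑ v, |x v - y v| ≤ ξ) :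
    clipNormSq x ξ ≤ ∑ v, y v ^ 2 := by
  refine csInf_le ⟨0, ?_⟩ ⟨y, hy, hξ, rfl⟩
  rintro r ⟨z, -, -, rfl⟩
  positivity

theorem exists_of_clipNormSq_lt {W : Type*} [Fintype W] {x : W → ℝ} {ξ c : ℝ}
    (hx : ∀ v, 0 ≤ x v) (hξ : 0 ≤ ξ) (h : clipNormSq x ξ < c) :
    ∃ y : W → ℝ, (∀ v, 0 ≤ y v ∧ y v ≤ x v) ∧ ∑ v, |x v - y v| ≤ ξ ∧ ∑ v, y v ^ 2 < c := by
  unfold clipNormSq at h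
  obtain ⟨r, ⟨y, hy, hy', rfl⟩, hr⟩ := exists_lt_of_csInf_lt
    (by exact ⟨∑ v, x v ^ 2, x, fun v => ⟨hx v, le_rfl⟩, by simpa using hξ, rfl⟩) h
  exact ⟨y, hy, hy', hr⟩

/-- The vertices of probability at least `1/(6N)` carry little mass when the `1/4`-clipped norm is
small. -/
theorem heavy_mass_le {W : Type*} [Fintype W] {p : W → ℝ} (hp : ∀ v, 0 ≤ p v)
    (hp1 : ∑ v, p v = 1) {N : ℝ} (hN : 0 < N) {c : ℝ} (hc : 300 * N * c ≤ 1 / 200)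
    (h : clipNormSq p (1 / 4) < c) :
    ∑ v with 1 / (6 * N) ≤ p v, p v ≤ 26 / 100 := by
  obtain ⟨y, hy, hy1, hy2⟩ := exists_of_clipNormSq_lt hp (by norm_num) h
  have key : ∀ v, 1 / (6 * N) ≤ p v →
      p v ≤ |p v - y v| + 300 * N * y v ^ 2 + p v / 200 := by
    intro v hv
    have h1 := le_abs_self (p v - y v)
    have h2 : y v ≤ 300 * N * y v ^ 2 + 1 / (1200 * N) := by
      have h3 : 300 * N * y v ^ 2 + 1 / (1200 * N) - y v =
          300 * N * (y v - 1 / (600 * N)) ^ 2 := by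
        field_simp
        ring
      have h4 : 0 ≤ 300 * N * (y v - 1 / (600 * N)) ^ 2 := by positivity
      linarith
    have h5 : 1 / (1200 * N) = 1 / (6 * N) / 200 := by
      field_simp
      norm_num
    linarith
  calc ∑ v with 1 / (6 * N) ≤ p v, p v
      ≤ ∑ v with 1 / (6 * N) ≤ p v, (|p v - y v| + 300 * N * y v ^ 2 + p v / 200) :=
        Finset.sum_le_sum fun v hv => key v (Finset.mem_filter.1 hv).2
    _ ≤ ∑ v, (|p v - y v| + 300 * N * y v ^ 2 + p v / 200) := by
        refine Finset.sum_le_sum_of_subset_of_nonneg (Finset.subset_univ _) fun v _ _ => ?_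
        have := hp v
        positivity
    _ = ∑ v, |p v - y v| + 300 * N * ∑ v, y v ^ 2 + 1 / 200 := by
        rw [Finset.sum_add_distrib, Finset.sum_add_distrib, ← Finset.mul_sum, ← Finset.sum_div,
          hp1]
    _ ≤ 26 / 100 := by
        have : 300 * N * ∑ v, y v ^ 2 ≤ 300 * N * c :=
          mul_le_mul_of_nonneg_left hy2.le (by positivity)
        linarith

/-- The vertices of probability at least `c` carry large mass when the `ξ`-clipped norm
exceeds `c`. -/
theorem lt_heavy_mass {W : Type*} [Fintype W] {p : W → ℝ} (hp : ∀ v, 0 ≤ p v)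
    (hp1 : ∑ v, p v = 1) {c ξ : ℝ} (hc : 0 ≤ c) (h : c < clipNormSq p ξ) :
    ξ < ∑ v with c ≤ p v, p v := by
  by_contra! hle
  refine absurd h (not_lt.2 ?_)
  have h1 : clipNormSq p ξ ≤ ∑ v, (if c ≤ p v then 0 else p v) ^ 2 := by
    refine clipNormSq_le (fun v => ?_) (le_trans (le_of_eq ?_) hle)
    · split_ifs
      · exact ⟨le_rfl, hp v⟩
      · exact ⟨hp v, le_rfl⟩
    · rw [Finset.sum_filter]
      refine Finset.sum_congr rfl fun v _ => ?_
      split_ifs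
      · rw [sub_zero, abs_of_nonneg (hp v)]
      · simp
  refine h1.trans ?_
  calc ∑ v, (if c ≤ p v then 0 else p v) ^ 2 ≤ ∑ v, c * p v := by
        refine Finset.sum_le_sum fun v _ => ?_
        split_ifs with hv
        · have := mul_nonneg hc (hp v)
          simpa using this
        · rw [pow_two]
          exact mul_le_mul_of_nonneg_right (not_le.1 hv).le (hp v)
    _ = c := by rw [← Finset.mul_sum, hp1, mul_one]

theorem sum_card_fiber_eq {V : Type*} [DecidableEq V] {n : ℕ} (f : Fin n → V)
    (T : Finset V) :
    ∑ v ∈ T, (Finset.univ.filter fun i => f i = v).card =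
      (Finset.univ.filter fun i => f i ∈ T).card := by
  rw [Finset.card_eq_sum_card_fiberwise (f := f) (s := Finset.univ.filter fun i => f i ∈ T)
    (t := T)
    (fun i hi => (Finset.mem_filter.1 (Finset.mem_coe.1 hi)).2)]
  refine Finset.sum_congr rfl fun v hv => ?_
  congr 1
  ext i
  simp only [Finset.mem_filter, Finset.mem_univ, true_and]
  exact ⟨fun h => ⟨h ▸ hv, h⟩, fun h => h.2⟩

/-- Probability of the event `A` under `n` independent samples from `p`. -/
def sampleProb {V : Type*} [Fintype V] (p : V → ℝ) (n : ℕ) (A : (Fin n → V) → Prop) : ℝ :=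
  ∑ f : Fin n → V, if A f then ∏ i, p (f i) else 0

section sampleProb

variable {V : Type*} [Fintype V] {p : V → ℝ} {n : ℕ}

theorem sampleProb_mono (hp : ∀ v, 0 ≤ p v) {A B : (Fin n → V) → Prop} (h : ∀ f, A f → B f) :
    sampleProb p n A ≤ sampleProb p n B := by
  refine Finset.sum_le_sum fun f _ => ?_
  have := Finset.prod_nonneg fun i (_ : i ∈ Finset.univ) => hp (f i)
  by_cases hA : A f
  · simp [hA, h f hA]
  · rw [if_neg hA]
    split_ifs <;> simp [this]

theorem sampleProb_or_le (hp : ∀ v, 0 ≤ p v) (A B : (Fin n → V) → Prop) :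
    sampleProb p n (fun f => A f ∨ B f) ≤ sampleProb p n A + sampleProb p n B := by
  unfold sampleProb
  rw [← Finset.sum_add_distrib]
  refine Finset.sum_le_sum fun f _ => ?_
  have := Finset.prod_nonneg fun i (_ : i ∈ Finset.univ) => hp (f i)
  by_cases hA : A f <;> by_cases hB : B f <;> simp [hA, hB, this]

theorem sampleProb_exists_le (hp : ∀ v, 0 ≤ p v) {ι : Type*} (S : Finset ι)
    (A : ι → (Fin n → V) → Prop) :
    sampleProb p n (fun f => ∃ v ∈ S, A v f) ≤ ∑ v ∈ S, sampleProb p n (A v) := by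
  unfold sampleProb
  rw [Finset.sum_comm]
  refine Finset.sum_le_sum fun f _ => ?_
  have h0 := Finset.prod_nonneg fun i (_ : i ∈ Finset.univ) => hp (f i)
  have h1 : ∀ v ∈ S, 0 ≤ if A v f then ∏ i, p (f i) else 0 := by
    intro v _
    split_ifs <;> simp [h0]
  split_ifs with h
  · obtain ⟨v, hv, hA⟩ := h
    refine le_trans (le_of_eq ?_) (Finset.single_le_sum h1 hv)
    simp [hA]
  · exact Finset.sum_nonneg h1

theorem sum_prod_eq_one (hp1 : ∑ v, p v = 1) (n : ℕ) :
    ∑ f : Fin n → V, ∏ i, p (f i) = 1 := by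
  rw [← Fintype.sum_pow, hp1, one_pow]

theorem sampleProb_add_not (hp1 : ∑ v, p v = 1) (A : (Fin n → V) → Prop) :
    sampleProb p n A + sampleProb p n (fun f => ¬ A f) = 1 := by
  unfold sampleProb
  rw [← Finset.sum_add_distrib, ← sum_prod_eq_one hp1 n]
  refine Finset.sum_congr rfl fun f _ => ?_
  by_cases hA : A f <;> simp [hA]

theorem sampleProb_le_of_le (hp : ∀ v, 0 ≤ p v) {A : (Fin n → V) → Prop}
    {g : (Fin n → V) → ℝ} (hg : ∀ f, 0 ≤ g f) (hA : ∀ f, A f → 1 ≤ g f) :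
    sampleProb p n A ≤ ∑ f : Fin n → V, g f * ∏ i, p (f i) := by
  refine Finset.sum_le_sum fun f _ => ?_
  have h0 := Finset.prod_nonneg fun i (_ : i ∈ Finset.univ) => hp (f i)
  split_ifs with h
  · exact le_mul_of_one_le_left h0 (hA f h)
  · exact mul_nonneg (hg f) h0

variable [DecidableEq V]

/-- Moment generating function of the number of samples landing in `S`. -/
theorem sum_pow_card_mul_prod (hp1 : ∑ v, p v = 1) (n : ℕ) (S : Finset V) (a : ℝ) :
    ∑ f : Fin n → V, a ^ (Finset.univ.filter fun i => f i ∈ S).card * ∏ i, p (f i) =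
      (1 + (a - 1) * ∑ v ∈ S, p v) ^ n := by
  have h1 : 1 + (a - 1) * ∑ v ∈ S, p v = ∑ v, (if v ∈ S then a else 1) * p v := by
    have h2 : ∀ v, (if v ∈ S then a else 1) * p v = p v + if v ∈ S then (a - 1) * p v else 0 := by
      intro v
      split_ifs <;> ring
    simp_rw [h2, Finset.sum_add_distrib, hp1, ← Finset.sum_filter, Finset.filter_univ_mem,
      ← Finset.mul_sum]
  rw [h1, Fintype.sum_pow]
  refine Finset.sum_congr rfl fun f _ => ?_
  rw [Finset.prod_mul_distrib, Finset.prod_ite]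
  simp

theorem sampleProb_card_ge_le (hp : ∀ v, 0 ≤ p v) (hp1 : ∑ v, p v = 1) (S : Finset V)
    (hS : ∑ v ∈ S, p v ≤ 26 / 100) :
    sampleProb p n (fun f => n ≤ 3 * (Finset.univ.filter fun i => f i ∈ S).card) ≤
      (997 / 1000) ^ n := by
  refine (sampleProb_le_of_le hp (g := fun f => ((5 : ℝ) / 6) ^ n *
    ((6 / 5 : ℝ) ^ 3) ^ (Finset.univ.filter fun i => f i ∈ S).card)
    (fun f => by positivity) fun f hf => ?_).trans ?_
  · rw [← pow_mul]
    calc (1 : ℝ) = (5 / 6) ^ n * (6 / 5) ^ n := by rw [← mul_pow]; norm_num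
      _ ≤ _ := by gcongr; norm_num
  · simp_rw [mul_assoc]
    rw [← Finset.mul_sum, sum_pow_card_mul_prod hp1, ← mul_pow]
    have h0 : 0 ≤ ∑ v ∈ S, p v := Finset.sum_nonneg fun v _ => hp v
    refine pow_le_pow_left₀ ?_ ?_ n
    · norm_num; linarith
    · norm_num; linarith

theorem sampleProb_card_lt_le (hp : ∀ v, 0 ≤ p v) (hp1 : ∑ v, p v = 1) (S : Finset V)
    (hS : 3 / 8 ≤ ∑ v ∈ S, p v) :
    sampleProb p n (fun f => 3 * (Finset.univ.filter fun i => f i ∈ S).card < n) ≤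
      (997 / 1000) ^ n := by
  refine (sampleProb_le_of_le hp (g := fun f => ((20 : ℝ) / 19) ^ n *
    ((19 / 20 : ℝ) ^ 3) ^ (Finset.univ.filter fun i => f i ∈ S).card)
    (fun f => by positivity) fun f hf => ?_).trans ?_
  · rw [← pow_mul]
    calc (1 : ℝ) = (20 / 19) ^ n * (19 / 20) ^ n := by rw [← mul_pow]; norm_num
      _ ≤ _ := by
        refine mul_le_mul_of_nonneg_left ?_ (by positivity)
        exact pow_le_pow_of_le_one (by norm_num) (by norm_num) hf.le
  · simp_rw [mul_assoc]
    rw [← Finset.mul_sum, sum_pow_card_mul_prod hp1, ← mul_pow]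
    have h0 : ∑ v ∈ S, p v ≤ 1 := hp1 ▸
      Finset.sum_le_sum_of_subset_of_nonneg (Finset.subset_univ _) fun v _ _ => hp v
    refine pow_le_pow_left₀ ?_ ?_ n
    · norm_num; linarith
    · norm_num; linarith

theorem sum_pow_card_eq_mul_prod (hp1 : ∑ v, p v = 1) (n : ℕ) (v : V) (a : ℝ) :
    ∑ f : Fin n → V, a ^ (Finset.univ.filter fun i => f i = v).card * ∏ i, p (f i) =
      (1 + (a - 1) * p v) ^ n := by
  simpa using sum_pow_card_mul_prod hp1 n {v} a

/-- A vertex of probability at least `1/N` receives fewer than `N/2` of `N²` samples with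
exponentially small probability. -/
theorem sampleProb_count_lt_le (hp : ∀ v, 0 ≤ p v) (hp1 : ∑ v, p v = 1) {N : ℕ} (hN : 0 < N)
    (v : V) (hv : 1 / (N : ℝ) ≤ p v) :
    sampleProb p (N ^ 2) (fun f => 2 * (Finset.univ.filter fun i => f i = v).card < N) ≤
      (997 / 1000) ^ N := by
  refine (sampleProb_le_of_le hp (g := fun f => (2 : ℝ) ^ N *
    (1 / 4 : ℝ) ^ (Finset.univ.filter fun i => f i = v).card)
    (fun f => by positivity) fun f hf => ?_).trans ?_
  · have h4 : (1 / 4 : ℝ) = (1 / 2) ^ 2 := by norm_num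
    rw [h4, ← pow_mul]
    calc (1 : ℝ) = 2 ^ N * (1 / 2) ^ N := by rw [← mul_pow]; norm_num
      _ ≤ _ := by
        refine mul_le_mul_of_nonneg_left ?_ (by positivity)
        exact pow_le_pow_of_le_one (by norm_num) (by norm_num) hf.le
  · simp_rw [mul_assoc]
    rw [← Finset.mul_sum, sum_pow_card_eq_mul_prod hp1, pow_two, pow_mul, ← mul_pow]
    have hN' : (0 : ℝ) < N := by exact_mod_cast hN
    have hv1 : p v ≤ 1 := hp1 ▸ Finset.single_le_sum (fun u _ => hp u) (Finset.mem_univ v)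
    have h0 : 0 ≤ 1 + (1 / 4 - 1) * p v := by linarith
    refine pow_le_pow_left₀ (by positivity) ?_ N
    have h1 : (1 + (1 / 4 - 1) * p v) ^ N ≤ Real.exp (-(3 / 4)) := by
      calc (1 + (1 / 4 - 1) * p v) ^ N ≤ (Real.exp (-(3 / 4) * (1 / N))) ^ N := by
            refine pow_le_pow_left₀ h0 ?_ N
            have := Real.add_one_le_exp (-(3 / 4) * (1 / (N : ℝ)))
            linarith
        _ = Real.exp (-(3 / 4)) := by
            rw [← Real.exp_nat_mul]
            congr 1
            field_simp
    have h2 := Real.quadratic_le_exp_of_nonneg (x := 3 / 4) (by norm_num)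
    have h3 : Real.exp (-(3 / 4)) ≤ 1 / (65 / 32) := by
      rw [Real.exp_neg, ← one_div]
      exact one_div_le_one_div_of_le (by norm_num) (le_trans (by norm_num) h2)
    calc 2 * (1 + (1 / 4 - 1) * p v) ^ N ≤ 2 * (1 / (65 / 32)) := by gcongr; exact h1.trans h3
      _ ≤ _ := by norm_num

/-- A vertex of probability at most `1/(6N)` receives at least `N/2` of `N²` samples with
exponentially small probability, proportional to its own probability. -/
theorem sampleProb_count_ge_le (hp : ∀ v, 0 ≤ p v) (hp1 : ∑ v, p v = 1) {N : ℕ} (hN : 0 < N)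
    (v : V) (hv : p v ≤ 1 / (6 * (N : ℝ))) :
    sampleProb p (N ^ 2) (fun f => N ≤ 2 * (Finset.univ.filter fun i => f i = v).card) ≤
      6 * N ^ 2 * (997 / 1000) ^ N * p v := by
  have hN' : (0 : ℝ) < N := by exact_mod_cast hN
  have hpow : (2 : ℝ) ≤ 2 ^ N := by
    simpa using pow_le_pow_right₀ (by norm_num : (1 : ℝ) ≤ 2) hN
  refine (sampleProb_le_of_le hp (g := fun f => 2 * (1 / 2 : ℝ) ^ N *
    ((4 : ℝ) ^ (Finset.univ.filter fun i => f i = v).card - 1))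
    (fun f => ?_) fun f hf => ?_).trans ?_
  · have : (1 : ℝ) ≤ 4 ^ (Finset.univ.filter fun i => f i = v).card :=
      one_le_pow₀ (by norm_num)
    have := sub_nonneg.2 this
    positivity
  · have h4 : (4 : ℝ) = 2 ^ 2 := by norm_num
    have h5 : (2 : ℝ) ^ N ≤ 4 ^ (Finset.univ.filter fun i => f i = v).card := by
      rw [h4, ← pow_mul]
      exact pow_le_pow_right₀ (by norm_num) hf
    calc (1 : ℝ) = 2 * (1 / 2) ^ N * (2 ^ N / 2) := by
          have : (1 / 2 : ℝ) ^ N * 2 ^ N = 1 := by rw [← mul_pow]; norm_num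
          linarith
      _ ≤ _ := by gcongr; linarith
  · simp_rw [mul_assoc]
    rw [← Finset.mul_sum, ← Finset.mul_sum]
    simp_rw [sub_mul]
    rw [Finset.sum_sub_distrib, sum_pow_card_eq_mul_prod hp1]
    simp_rw [one_mul]
    rw [sum_prod_eq_one hp1]
    set x : ℝ := N ^ 2 * (3 * p v) with hx
    have hpv := hp v
    have hx0 : 0 ≤ x := by positivity
    have h1 : (1 + (4 - 1) * p v) ^ (N ^ 2) ≤ Real.exp x := by
      calc (1 + (4 - 1) * p v) ^ (N ^ 2) ≤ (Real.exp (3 * p v)) ^ (N ^ 2) := by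
            refine pow_le_pow_left₀ (by linarith) ?_ _
            have := Real.add_one_le_exp (3 * p v)
            linarith
        _ = Real.exp x := by
            rw [← Real.exp_nat_mul, hx]
            push_cast
            rfl
    have h2 : Real.exp x - 1 ≤ x * Real.exp x := by
      have h3 := Real.add_one_le_exp (-x)
      have h4 : Real.exp (-x) * Real.exp x = 1 := by rw [← Real.exp_add]; simp
      have := mul_le_mul_of_nonneg_right h3 (Real.exp_pos x).le
      linarith
    have h3 : Real.exp x ≤ (165 / 100) ^ N := by
      have h4 : x ≤ N * (1 / 2) := by
        calc x ≤ N ^ 2 * (3 * (1 / (6 * (N : ℝ)))) := by rw [hx]; gcongr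
          _ = N * (1 / 2) := by field_simp; norm_num
      have h5 : Real.exp (1 / 2) ≤ 165 / 100 := by
        have h6 : Real.exp (1 / 2) ^ 2 = Real.exp 1 := by
          rw [← Real.exp_nat_mul]; norm_num
        have := Real.exp_one_lt_d9
        refine abs_le_of_sq_le_sq' ?_ (by norm_num) |>.2
        rw [h6]
        linarith
      calc Real.exp x ≤ Real.exp (N * (1 / 2)) := Real.exp_le_exp.2 h4
        _ = Real.exp (1 / 2) ^ N := Real.exp_nat_mul _ _
        _ ≤ _ := pow_le_pow_left₀ (Real.exp_pos _).le h5 N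
    calc 2 * ((1 / 2) ^ N * ((1 + (4 - 1) * p v) ^ (N ^ 2) - 1))
        ≤ 2 * ((1 / 2) ^ N * (x * (165 / 100) ^ N)) := by
          gcongr
          calc _ ≤ Real.exp x - 1 := by linarith
            _ ≤ x * Real.exp x := h2
            _ ≤ _ := by gcongr
      _ = 2 * x * (165 / 200) ^ N := by
          have : (165 / 200 : ℝ) ^ N = (1 / 2) ^ N * (165 / 100) ^ N := by
            rw [← mul_pow]; norm_num
          rw [this]; ring
      _ ≤ 2 * x * (997 / 1000) ^ N :=
          mul_le_mul_of_nonneg_left (pow_le_pow_left₀ (by norm_num) (by norm_num) N) (by positivity)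
      _ = _ := by rw [hx]; ring

/-- When the heavy vertices carry mass at most `0.26`, the frequently sampled vertices are
unlikely to absorb a third of the samples. -/
theorem sampleProb_frequent_ge_le (hp : ∀ v, 0 ≤ p v) (hp1 : ∑ v, p v = 1) {N : ℕ}
    (hN : 0 < N) (hH : ∑ v with 1 / (6 * (N : ℝ)) ≤ p v, p v ≤ 26 / 100) :
    sampleProb p (N ^ 2) (fun f => N ^ 2 ≤ 3 * ∑ v with
        N ≤ 2 * (Finset.univ.filter fun i => f i = v).card,
          (Finset.univ.filter fun i => f i = v).card) ≤
      (997 / 1000) ^ (N ^ 2) + 6 * N ^ 2 * (997 / 1000) ^ N := by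
  set H : Finset V := Finset.univ.filter fun v => 1 / (6 * (N : ℝ)) ≤ p v with hHdef
  have hlight : ∑ v ∈ Hᶜ, sampleProb p (N ^ 2)
      (fun f => N ≤ 2 * (Finset.univ.filter fun i => f i = v).card) ≤
      6 * N ^ 2 * (997 / 1000) ^ N := by
    calc _ ≤ ∑ v ∈ Hᶜ, 6 * (N : ℝ) ^ 2 * (997 / 1000) ^ N * p v := by
          refine Finset.sum_le_sum fun v hv => sampleProb_count_ge_le hp hp1 hN v ?_
          simp only [hHdef, Finset.mem_compl, Finset.mem_filter, Finset.mem_univ, true_and,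
            not_le] at hv
          exact hv.le
      _ ≤ ∑ v, 6 * (N : ℝ) ^ 2 * (997 / 1000) ^ N * p v := by
          refine Finset.sum_le_sum_of_subset_of_nonneg (Finset.subset_univ _) fun v _ _ => ?_
          have := hp v
          positivity
      _ = _ := by rw [← Finset.mul_sum, hp1, mul_one]
  refine le_trans (sampleProb_mono hp (B := fun f =>
    (N ^ 2 ≤ 3 * (Finset.univ.filter fun i => f i ∈ H).card) ∨
    ∃ v ∈ Hᶜ, N ≤ 2 * (Finset.univ.filter fun i => f i = v).card) fun f hf => ?_)
    ((sampleProb_or_le hp _ _).trans (add_le_add (sampleProb_card_ge_le hp hp1 H hH)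
      ((sampleProb_exists_le hp _ _).trans hlight)))
  by_contra! hcon
  obtain ⟨h1, h2⟩ := hcon
  refine absurd hf (not_le.2 (lt_of_le_of_lt ?_ h1))
  rw [← sum_card_fiber_eq]
  refine Nat.mul_le_mul_left 3 (Finset.sum_le_sum_of_subset fun v hv => ?_)
  by_contra hvH
  exact absurd (Finset.mem_filter.1 hv).2 (not_le.2 (h2 v (Finset.mem_compl.2 hvH)))

/-- When the heavy vertices carry mass at least `3/8`, the frequently sampled vertices are
likely to absorb a third of the samples. -/
theorem sampleProb_frequent_lt_le (hp : ∀ v, 0 ≤ p v) (hp1 : ∑ v, p v = 1) {N : ℕ}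
    (hN : 0 < N) (hH : 3 / 8 ≤ ∑ v with 1 / (N : ℝ) ≤ p v, p v) :
    sampleProb p (N ^ 2) (fun f => 3 * ∑ v with
        N ≤ 2 * (Finset.univ.filter fun i => f i = v).card,
          (Finset.univ.filter fun i => f i = v).card < N ^ 2) ≤
      (997 / 1000) ^ (N ^ 2) + N * (997 / 1000) ^ N := by
  have hN' : (0 : ℝ) < N := by exact_mod_cast hN
  set H : Finset V := Finset.univ.filter fun v => 1 / (N : ℝ) ≤ p v with hHdef
  have hcard : (H.card : ℝ) ≤ N := by
    have h1 : H.card • (1 / (N : ℝ)) ≤ ∑ v ∈ H, p v :=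
      Finset.card_nsmul_le_sum _ _ _ fun v hv => (Finset.mem_filter.1 hv).2
    have h2 : ∑ v ∈ H, p v ≤ 1 := hp1 ▸
      Finset.sum_le_sum_of_subset_of_nonneg (Finset.subset_univ _) fun v _ _ => hp v
    rw [nsmul_eq_mul, mul_one_div] at h1
    exact (div_le_one hN').1 (h1.trans h2)
  have hheavy : ∑ v ∈ H, sampleProb p (N ^ 2)
      (fun f => 2 * (Finset.univ.filter fun i => f i = v).card < N) ≤
      N * (997 / 1000) ^ N := by
    calc _ ≤ H.card • ((997 / 1000 : ℝ) ^ N) := Finset.sum_le_card_nsmul _ _ _ fun v hv =>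
            sampleProb_count_lt_le hp hp1 hN v (Finset.mem_filter.1 hv).2
      _ ≤ _ := by rw [nsmul_eq_mul]; gcongr
  refine le_trans (sampleProb_mono hp (B := fun f =>
    (3 * (Finset.univ.filter fun i => f i ∈ H).card < N ^ 2) ∨
    ∃ v ∈ H, 2 * (Finset.univ.filter fun i => f i = v).card < N) fun f hf => ?_)
    ((sampleProb_or_le hp _ _).trans (add_le_add (sampleProb_card_lt_le hp hp1 H hH)
      ((sampleProb_exists_le hp _ _).trans hheavy)))
  by_contra! hcon
  obtain ⟨h1, h2⟩ := hcon
  refine absurd hf (not_lt.2 (h1.trans ?_))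
  rw [← sum_card_fiber_eq]
  exact Nat.mul_le_mul_left 3 (Finset.sum_le_sum_of_subset fun v hv =>
    Finset.mem_filter.2 ⟨Finset.mem_univ _, h2 v hv⟩)

end sampleProb

theorem pow_997_le_half_pow {m k : ℕ} (h : 256 * k ≤ m) :
    (997 / 1000 : ℝ) ^ m ≤ (1 / 2) ^ k := by
  calc (997 / 1000 : ℝ) ^ m ≤ (997 / 1000) ^ (256 * k) :=
        pow_le_pow_of_le_one (by norm_num) (by norm_num) h
    _ = ((997 / 1000) ^ 256) ^ k := pow_mul _ _ _
    _ ≤ _ := pow_le_pow_left₀ (by positivity) (by norm_num) k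

/-- Both error terms are exponentially small in `ℓ`. -/
theorem failure_le {ℓ : ℕ} (hℓ : 2 ^ 20 ≤ ℓ) :
    (997 / 1000 : ℝ) ^ ((ℓ ^ 7) ^ 2) + 6 * ((ℓ ^ 7 : ℕ) : ℝ) ^ 2 * (997 / 1000) ^ (ℓ ^ 7) ≤
      (1 / 2) ^ (ℓ + 1) := by
  have hge : 256 * (15 * ℓ + 5) ≤ ℓ ^ 7 := by
    calc 256 * (15 * ℓ + 5) ≤ 2 ^ 20 * ℓ := by omega
      _ ≤ ℓ * ℓ := Nat.mul_le_mul_right _ hℓ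
      _ = ℓ ^ 2 := (pow_two ℓ).symm
      _ ≤ ℓ ^ 7 := Nat.pow_le_pow_right (by omega) (by norm_num)
  have hge2 : 256 * (ℓ + 2) ≤ (ℓ ^ 7) ^ 2 := by
    calc 256 * (ℓ + 2) ≤ ℓ ^ 7 := by omega
      _ ≤ (ℓ ^ 7) ^ 2 := Nat.le_self_pow (by norm_num) _
  have h1 := pow_997_le_half_pow hge2
  have h2 := pow_997_le_half_pow hge
  have h3 : 6 * ((ℓ ^ 7 : ℕ) : ℝ) ^ 2 ≤ 2 ^ (14 * ℓ + 3) := by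
    have h4 : (ℓ : ℝ) ≤ 2 ^ ℓ := by exact_mod_cast Nat.lt_two_pow_self.le
    calc 6 * ((ℓ ^ 7 : ℕ) : ℝ) ^ 2 = 6 * (ℓ : ℝ) ^ 14 := by push_cast; ring
      _ ≤ 8 * ((2 : ℝ) ^ ℓ) ^ 14 := by gcongr; norm_num
      _ = 2 ^ (14 * ℓ + 3) := by rw [← pow_mul, pow_add, mul_comm ℓ 14]; ring
  have h5 : 6 * ((ℓ ^ 7 : ℕ) : ℝ) ^ 2 * (997 / 1000) ^ (ℓ ^ 7) ≤ (1 / 2) ^ (ℓ + 2) := by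
    calc _ ≤ (2 : ℝ) ^ (14 * ℓ + 3) * (1 / 2) ^ (15 * ℓ + 5) := by gcongr
      _ = (2 : ℝ) ^ (14 * ℓ + 3) * ((1 / 2) ^ (14 * ℓ + 3) * (1 / 2) ^ (ℓ + 2)) := by
          rw [← pow_add]; congr 2; ring
      _ = (1 / 2) ^ (ℓ + 2) := by rw [← mul_assoc, ← mul_pow]; norm_num
  have h6 : (1 / 2 : ℝ) ^ (ℓ + 1) = (1 / 2) ^ (ℓ + 2) + (1 / 2) ^ (ℓ + 2) := by ring
  linarith

theorem two_pow_le_of_zpow_le {ε : ℝ} (hε0 : 0 < ε) (hε : ε ≤ 1 / 2) {ℓ : ℕ}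
    (hℓ : ε ^ (-20 : ℤ) ≤ (ℓ : ℝ)) : 2 ^ 20 ≤ ℓ ∧ 1 / ε ≤ ℓ := by
  have h2 : 2 ≤ 1 / ε := by rw [le_div_iff₀ hε0]; linarith
  have h : (1 / ε) ^ 20 ≤ (ℓ : ℝ) := by
    refine le_trans (le_of_eq ?_) hℓ
    rw [zpow_neg, one_div, inv_pow]
    norm_cast
  refine ⟨?_, (le_self_pow₀ (by linarith) (by norm_num)).trans h⟩
  have := (pow_le_pow_left₀ (by norm_num) h2 20).trans h
  exact_mod_cast this

/-- drawing `w = ℓ¹⁴` i.i.d. samples from `p_s^ℓ` and letting `T` be the set of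
vertices receiving at least `ℓ⁷/2` samples, with probability at least `1 - 2^{-1/ε}`:
if the `1/4`-clipped squared norm is below `ℓ⁻⁸/400` then the samples landing in `T` number
less than `w/3`, and if the `3/8`-clipped squared norm exceeds `ℓ⁻⁷` then at least `w/3`. -/
theorem estclip_guarantee {V : Type} [Fintype V] [DecidableEq V] (G : SimpleGraph V)
    [DecidableRel G.Adj] (d : ℕ) (hd : 1 ≤ d) (hdeg : ∀ v, G.degree v ≤ d)
    (ε : ℝ) (hε0 : 0 < ε) (hε : ε ≤ 1 / 2) (ℓ : ℕ) (hℓ : ε ^ (-20 : ℤ) ≤ (ℓ : ℝ)) (s : V) :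
    1 - (2 : ℝ) ^ (-(1 / ε)) ≤
      ∑ f : Fin (ℓ ^ 14) → V,
        if ((clipNormSq (walkDist G d ℓ s) (1 / 4) < 1 / (ℓ : ℝ) ^ 8 / 400 →
              (∑ v ∈ Finset.univ.filter
                    (fun v : V =>
                      (ℓ : ℝ) ^ 7 / 2 ≤ ((Finset.univ.filter fun i => f i = v).card : ℝ)),
                  ((Finset.univ.filter fun i => f i = v).card : ℝ)) < (ℓ : ℝ) ^ 14 / 3) ∧
            (1 / (ℓ : ℝ) ^ 7 < clipNormSq (walkDist G d ℓ s) (3 / 8) →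
              (ℓ : ℝ) ^ 14 / 3 ≤
                ∑ v ∈ Finset.univ.filter
                    (fun v : V =>
                      (ℓ : ℝ) ^ 7 / 2 ≤ ((Finset.univ.filter fun i => f i = v).card : ℝ)),
                  ((Finset.univ.filter fun i => f i = v).card : ℝ))) then
          ∏ i : Fin (ℓ ^ 14), walkDist G d ℓ s (f i)
        else 0 := by
  obtain ⟨hℓ2, hεℓ⟩ := two_pow_le_of_zpow_le hε0 hε hℓ
  set p := walkDist G d ℓ s
  have hp : ∀ v, 0 ≤ p v := walkDist_nonneg G hd hdeg ℓ s
  have hp1 : ∑ v, p v = 1 := walkDist_sum G d ℓ s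
  have hℓ0 : 0 < ℓ := lt_of_lt_of_le (by norm_num) hℓ2
  have hℓR : (2 ^ 20 : ℝ) ≤ ℓ := by exact_mod_cast hℓ2
  have hℓR0 : (0 : ℝ) < ℓ := by exact_mod_cast hℓ0
  have hN : 0 < ℓ ^ 7 := by positivity
  have hw : ℓ ^ 14 = (ℓ ^ 7) ^ 2 := by ring
  have hthr : ∀ c : ℕ, (ℓ : ℝ) ^ 7 / 2 ≤ (c : ℝ) ↔ ℓ ^ 7 ≤ 2 * c := by
    intro c
    rw [div_le_iff₀ (by norm_num), mul_comm]
    exact_mod_cast Iff.rfl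
  have hthird : ∀ c : ℕ, (ℓ : ℝ) ^ 14 / 3 ≤ (c : ℝ) ↔ (ℓ ^ 7) ^ 2 ≤ 3 * c := by
    intro c
    rw [div_le_iff₀ (by norm_num), mul_comm, ← hw]
    exact_mod_cast Iff.rfl
  have hδ : (1 / 2 : ℝ) ^ (ℓ + 1) + (1 / 2 : ℝ) ^ (ℓ + 1) ≤ 2 ^ (-(1 / ε)) := by
    calc (1 / 2 : ℝ) ^ (ℓ + 1) + (1 / 2 : ℝ) ^ (ℓ + 1) = (2 : ℝ) ^ (-(ℓ : ℝ)) := by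
          rw [Real.rpow_neg (by norm_num), Real.rpow_natCast, ← inv_pow]
          ring
      _ ≤ _ := Real.rpow_le_rpow_of_exponent_le (by norm_num) (by linarith)
  have hfail := failure_le hℓ2
  simp_rw [hthr, ← Nat.cast_sum, ← not_le (a := (ℓ : ℝ) ^ 14 / 3), hthird]
  generalize hn : ℓ ^ 14 = n
  obtain rfl : n = (ℓ ^ 7) ^ 2 := hn ▸ hw
  set c : (Fin ((ℓ ^ 7) ^ 2) → V) → ℕ := fun f => ∑ v with
    ℓ ^ 7 ≤ 2 * (Finset.univ.filter fun i => f i = v).card,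
      (Finset.univ.filter fun i => f i = v).card
  set A : Prop := clipNormSq p (1 / 4) < 1 / (ℓ : ℝ) ^ 8 / 400
  set B : Prop := 1 / (ℓ : ℝ) ^ 7 < clipNormSq p (3 / 8)
  have hbadA : sampleProb p _ (fun f => A ∧ (ℓ ^ 7) ^ 2 ≤ 3 * c f) ≤ (1 / 2) ^ (ℓ + 1) := by
    by_cases h : A
    · refine (sampleProb_mono hp fun f hf => hf.2).trans
        ((sampleProb_frequent_ge_le hp hp1 hN ?_).trans hfail)
      refine heavy_mass_le hp hp1 (by positivity) ?_ h
      have : 300 * ((ℓ ^ 7 : ℕ) : ℝ) * (1 / (ℓ : ℝ) ^ 8 / 400) = 3 / 4 / ℓ := by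
        push_cast
        field_simp
        norm_num
      rw [this, div_le_iff₀ hℓR0]
      linarith
    · simp only [sampleProb, h, false_and, if_false, Finset.sum_const_zero]
      positivity
  have hbadB : sampleProb p _ (fun f => B ∧ 3 * c f < (ℓ ^ 7) ^ 2) ≤ (1 / 2) ^ (ℓ + 1) := by
    by_cases h : B
    · refine (sampleProb_mono hp fun f hf => hf.2).trans
        ((sampleProb_frequent_lt_le hp hp1 hN ?_).trans (le_trans ?_ hfail))
      · push_cast
        exact (lt_heavy_mass hp hp1 (by positivity) h).le
      · have h1 : (1 : ℝ) ≤ ((ℓ ^ 7 : ℕ) : ℝ) := by exact_mod_cast hN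
        gcongr
        nlinarith
    · simp only [sampleProb, h, false_and, if_false, Finset.sum_const_zero]
      positivity
  have hsplit := sampleProb_add_not hp1 (n := (ℓ ^ 7) ^ 2) fun f =>
    (A → ¬ (ℓ ^ 7) ^ 2 ≤ 3 * c f) ∧ (B → (ℓ ^ 7) ^ 2 ≤ 3 * c f)
  have hbad : sampleProb p _ (fun f => ¬ ((A → ¬ (ℓ ^ 7) ^ 2 ≤ 3 * c f) ∧
      (B → (ℓ ^ 7) ^ 2 ≤ 3 * c f))) ≤ 2 ^ (-(1 / ε)) := by
    refine le_trans (sampleProb_mono hp fun f hf => ?_)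
      ((sampleProb_or_le hp _ _).trans ((add_le_add hbadA hbadB).trans hδ))
    by_contra! hcon
    exact hf ⟨fun ha => not_le.2 (hcon.1 ha), hcon.2⟩
  have hgoal : 1 - (2 : ℝ) ^ (-(1 / ε)) ≤ sampleProb p ((ℓ ^ 7) ^ 2) fun f =>
      (A → ¬ (ℓ ^ 7) ^ 2 ≤ 3 * c f) ∧ (B → (ℓ ^ 7) ^ 2 ≤ 3 * c f) := by linarith
  convert hgoal using 1
  refine Finset.sum_congr rfl fun f _ => ?_
  congr
end
end

section
/- Let p be a probability distribution on a finite set V, let ℓ ≥ 2 be an integer, and let H = {v ∈ V : p(v) ≥ ℓ^{−8}}. If ‖clip(p, 1/4)‖₂² < ℓ^{−8}/400, then Σ_{v∈H} p(v) ≤ 1/4 + 1/20. -/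
open scoped Classical

noncomputable section

/-- if the `1/4`-clipped squared norm of a probability distribution `p` is below
`ℓ⁻⁸/400`, then the total mass on vertices of probability at least `ℓ⁻⁸` is at most
`1/4 + 1/20`. -/
theorem heavy_mass_small {V : Type} [Fintype V] (p : V → ℝ)
    (hp : ∀ v, 0 ≤ p v) (hsum : ∑ v, p v = 1)
    (ℓ : ℕ) (hℓ : 2 ≤ ℓ)
    (h : clipNormSq p (1 / 4) < 1 / (ℓ : ℝ) ^ 8 / 400) :
    ∑ v ∈ Finset.univ.filter (fun v => 1 / (ℓ : ℝ) ^ 8 ≤ p v), p v ≤ 1 / 4 + 1 / 20 := by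
  obtain ⟨r, ⟨y, hy, hxy, rfl⟩, hr⟩ := exists_lt_of_csInf_lt
    (by exact ⟨_, p, fun v => ⟨hp v, le_rfl⟩, by simp, rfl⟩) h
  have ht : (0 : ℝ) < 1 / (ℓ : ℝ) ^ 8 := by
    have : (0 : ℝ) < ℓ := by exact_mod_cast (by omega : 0 < ℓ)
    positivity
  set t : ℝ := 1 / (ℓ : ℝ) ^ 8
  set H := Finset.univ.filter (fun v => t ≤ p v)
  have hmass : ∑ v ∈ H, p v ≤ 1 :=
    hsum ▸ Finset.sum_le_sum_of_subset_of_nonneg (Finset.subset_univ H) fun v _ _ => hp v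
  have hcard : (H.card : ℝ) * t ≤ 1 := by
    rw [← nsmul_eq_mul]
    exact (Finset.card_nsmul_le_sum H p t fun v hv => (Finset.mem_filter.1 hv).2).trans hmass
  have hclip : ∑ v ∈ H, p v - ∑ v ∈ H, y v ≤ 1 / 4 := by
    rw [← Finset.sum_sub_distrib]
    calc ∑ v ∈ H, (p v - y v) ≤ ∑ v ∈ H, |p v - y v| :=
          Finset.sum_le_sum fun v _ => le_abs_self _
      _ ≤ ∑ v, |p v - y v| :=
          Finset.sum_le_sum_of_subset_of_nonneg (Finset.subset_univ H) fun v _ _ => abs_nonneg _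
      _ ≤ 1 / 4 := hxy
  have hsq : ∑ v ∈ H, y v ^ 2 ≤ t / 400 :=
    (Finset.sum_le_sum_of_subset_of_nonneg (Finset.subset_univ H)
      fun v _ _ => sq_nonneg (y v)).trans hr.le
  have hcauchy : (∑ v ∈ H, y v) ^ 2 ≤ (1 / 20) ^ 2 := by
    calc (∑ v ∈ H, y v) ^ 2 ≤ H.card * ∑ v ∈ H, y v ^ 2 := sq_sum_le_card_mul_sum_sq
      _ ≤ H.card * (t / 400) := by gcongr
      _ ≤ (1 / 20) ^ 2 := by linarith
  have hy_mass : ∑ v ∈ H, y v ≤ 1 / 20 := (abs_le_of_sq_le_sq' hcauchy (by norm_num)).2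
  linarith
end
end

section
/- Let p be a probability distribution on a finite set V, let ℓ ≥ 2 be an integer, and let H′ = {v ∈ V : p(v) ≥ ℓ^{−7}}. If ‖clip(p, 3/8)‖₂² > ℓ^{−7}, then Σ_{v∈H′} p(v) ≥ 3/8. -/
open scoped Classical

noncomputable section

/-- if the `3/8`-clipped squared norm of a probability distribution `p` exceeds
`ℓ⁻⁷`, then the total mass on vertices of probability at least `ℓ⁻⁷` is at least `3/8`. -/
theorem heavy_mass_large {V : Type} [Fintype V] (p : V → ℝ)
    (hp : ∀ v, 0 ≤ p v) (hsum : ∑ v, p v = 1)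
    (ℓ : ℕ) (hℓ : 2 ≤ ℓ)
    (h : 1 / (ℓ : ℝ) ^ 7 < clipNormSq p (3 / 8)) :
    3 / 8 ≤ ∑ v ∈ Finset.univ.filter (fun v => 1 / (ℓ : ℝ) ^ 7 ≤ p v), p v := by
  by_contra! hlt
  set t : ℝ := 1 / (ℓ : ℝ) ^ 7
  have ht : 0 ≤ t := by positivity
  refine absurd h (not_lt.2 ?_)
  have hle : clipNormSq p (3 / 8) ≤ ∑ v, (if t ≤ p v then 0 else p v) ^ 2 := by
    refine csInf_le ⟨0, ?_⟩ ⟨fun v => if t ≤ p v then 0 else p v, fun v => ?_, ?_, rfl⟩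
    · rintro r ⟨y, -, -, rfl⟩
      positivity
    · have := hp v
      dsimp only
      split_ifs <;> simp [this]
    · refine le_trans (le_of_eq ?_) hlt.le
      rw [Finset.sum_filter]
      refine Finset.sum_congr rfl fun v _ => ?_
      dsimp only
      split_ifs <;> simp [abs_of_nonneg (hp v)]
  calc clipNormSq p (3 / 8) ≤ ∑ v, (if t ≤ p v then 0 else p v) ^ 2 := hle
    _ ≤ ∑ v, t * p v := by
      refine Finset.sum_le_sum fun v _ => ?_
      have := hp v
      split_ifs with hv
      · simpa using mul_nonneg ht this
      · rw [sq]
        exact mul_le_mul_of_nonneg_right (not_le.1 hv).le this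
    _ = t := by rw [← Finset.mul_sum, hsum, mul_one]
end
end

section
/- (Lovász–Simonovits) Let M be a symmetric Markov chain on a finite state set S of size m in which every state has holding probability at least 1/2, fix a start state s, and let h_t be the Lovász–Simonovits curve of the t-step distribution from s. Then for all integers t ≥ 1 and all k ∈ {0, 1, …, m}: h_t(k) ≤ (1/2)·[h_{t−1}(k − 2·min(k, m−k)·Φ(L_{k,t})) + h_{t−1}(k + 2·min(k, m−k)·Φ(L_{k,t}))]. -/
open scoped Classical

noncomputable section

/-- The permutation ordering the states by decreasing value of `p` (ties broken by the fixed
ordering of indices). -/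
def ordPerm {m : ℕ} (p : Fin m → ℝ) : Equiv.Perm (Fin m) :=
  Tuple.sort fun v => -p v

/-- The level set `L_k`: the first `k` states in decreasing order of `p`. -/
def levelSet {m : ℕ} (p : Fin m → ℝ) (k : ℕ) : Finset (Fin m) :=
  (Finset.univ.filter fun j : Fin m => (j : ℕ) < k).image (ordPerm p)

/-- The Lovász–Simonovits curve of `p`: at integer `k` it equals the sum of the `k` largest
entries of `p`, extended by linear interpolation. -/
def lsCurve {m : ℕ} (p : Fin m → ℝ) (x : ℝ) : ℝ :=
  (∑ j ∈ levelSet p ⌊x⌋₊, p j) +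
    (x - (⌊x⌋₊ : ℝ)) * (if h : ⌊x⌋₊ < m then p (ordPerm p ⟨⌊x⌋₊, h⟩) else 0)

/-- The conductance of a set `T` of states in the chain with transition matrix `M`. -/
def conduct {m : ℕ} (M : Matrix (Fin m) (Fin m) ℝ) (T : Finset (Fin m)) : ℝ :=
  (∑ u ∈ T, ∑ v ∈ Tᶜ, M u v) / min (T.card : ℝ) ((Tᶜ.card : ℝ))

theorem card_levelSet {m : ℕ} (p : Fin m → ℝ) {k : ℕ} (hk : k ≤ m) :
    (levelSet p k).card = k := by
  rw [levelSet, Finset.card_image_of_injective _ (ordPerm p).injective, Fin.card_filter_val_lt]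
  exact min_eq_right hk

theorem ordPerm_mem_levelSet {m : ℕ} (p : Fin m → ℝ) (k : ℕ) (j : Fin m) :
    ordPerm p j ∈ levelSet p k ↔ (j : ℕ) < k := by
  simp [levelSet]

theorem antitone_comp_ordPerm {m : ℕ} (p : Fin m → ℝ) {i j : Fin m} (h : i ≤ j) :
    p (ordPerm p j) ≤ p (ordPerm p i) :=
  neg_le_neg_iff.1 (Tuple.monotone_sort (fun v => -p v) h)

theorem lsCurve_natCast {m : ℕ} (p : Fin m → ℝ) (k : ℕ) :
    lsCurve p (k : ℝ) = ∑ j ∈ levelSet p k, p j := by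
  simp [lsCurve]

/-- On `[0, m]` the curve is given by a threshold value separating the level set from its
complement. -/
theorem exists_threshold_lsCurve {m : ℕ} (p : Fin m → ℝ) {x : ℝ} (h0 : 0 ≤ x) (hx : x ≤ m) :
    ∃ c : ℝ, lsCurve p x = (∑ j ∈ levelSet p ⌊x⌋₊, p j) + (x - (⌊x⌋₊ : ℝ)) * c ∧
      (∀ v ∈ levelSet p ⌊x⌋₊, c ≤ p v) ∧ ∀ v ∉ levelSet p ⌊x⌋₊, p v ≤ c := by
  by_cases h : ⌊x⌋₊ < m
  · refine ⟨p (ordPerm p ⟨⌊x⌋₊, h⟩), by rw [lsCurve, dif_pos h], fun v hv => ?_, fun v hv => ?_⟩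
    · obtain ⟨j, rfl⟩ := (ordPerm p).surjective v
      rw [ordPerm_mem_levelSet] at hv
      exact antitone_comp_ordPerm p (Fin.le_def.2 hv.le)
    · obtain ⟨j, rfl⟩ := (ordPerm p).surjective v
      rw [ordPerm_mem_levelSet, not_lt] at hv
      exact antitone_comp_ordPerm p (Fin.le_def.2 hv)
  · have hxm : x = ⌊x⌋₊ := le_antisymm (hx.trans (by exact_mod_cast not_lt.1 h)) (Nat.floor_le h0)
    refine ⟨-∑ v, |p v|, ?_, fun v _ => ?_, fun v hv => ?_⟩
    · rw [lsCurve, ← hxm, sub_self, zero_mul, zero_mul]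
    · exact (neg_le_neg (Finset.single_le_sum (f := fun v => |p v|)
        (fun _ _ => abs_nonneg _) (Finset.mem_univ v))).trans (neg_abs_le _)
    · obtain ⟨j, rfl⟩ := (ordPerm p).surjective v
      rw [ordPerm_mem_levelSet] at hv
      exact absurd (j.2.trans_le (not_lt.1 h)) hv

/-- The curve dominates every fractional selection of the states of the given total weight. -/
theorem sum_mul_le_lsCurve {m : ℕ} (p w : Fin m → ℝ) (hw0 : ∀ v, 0 ≤ w v) (hw1 : ∀ v, w v ≤ 1) :
    ∑ v, w v * p v ≤ lsCurve p (∑ v, w v) := by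
  set x := ∑ v, w v with hx
  have h0 : 0 ≤ x := Finset.sum_nonneg fun v _ => hw0 v
  have h1 : x ≤ m := by simpa using Finset.sum_le_sum fun v (_ : v ∈ Finset.univ) => hw1 v
  obtain ⟨c, hc, hin, hout⟩ := exists_threshold_lsCurve p h0 h1
  have hcard : (levelSet p ⌊x⌋₊).card = ⌊x⌋₊ := card_levelSet p (Nat.floor_le_of_le h1)
  have key : ∑ v, w v * (p v - c) ≤ ∑ v ∈ levelSet p ⌊x⌋₊, (p v - c) := by
    rw [← Finset.filter_univ_mem (levelSet p ⌊x⌋₊), Finset.sum_filter]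
    refine Finset.sum_le_sum fun v _ => ?_
    split_ifs with hv
    · exact mul_le_of_le_one_left (sub_nonneg.2 (hin v hv)) (hw1 v)
    · exact mul_nonpos_of_nonneg_of_nonpos (hw0 v) (sub_nonpos.2 (hout v hv))
  simp only [mul_sub, Finset.sum_sub_distrib, ← Finset.sum_mul, Finset.sum_const, hcard,
    nsmul_eq_mul, ← hx] at key
  rw [hc]
  linarith

theorem min_mul_conduct {m : ℕ} (M : Matrix (Fin m) (Fin m) ℝ) (T : Finset (Fin m)) :
    min (T.card : ℝ) ((m : ℝ) - T.card) * conduct M T = ∑ u ∈ T, ∑ v ∈ Tᶜ, M u v := by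
  have hc : ((Tᶜ.card : ℕ) : ℝ) = m - T.card := by
    rw [Finset.card_compl, Fintype.card_fin, Nat.cast_sub (by simpa using T.card_le_univ)]
  rw [conduct, hc]
  refine mul_div_cancel_of_imp' fun h => ?_
  rw [← hc] at h
  rcases min_choice (T.card : ℝ) (Tᶜ.card : ℝ) with h' | h' <;> rw [h', Nat.cast_eq_zero,
    Finset.card_eq_zero] at h <;> simp [h]

/-- One step of a lazy symmetric chain: the mass of `T` after the step is bounded by a chord of the
curve before the step. -/
theorem sum_vecMul_le_lsCurve {m : ℕ} (M : Matrix (Fin m) (Fin m) ℝ)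
    (hsymm : ∀ u v, M u v = M v u) (hnonneg : ∀ u v, 0 ≤ M u v)
    (hrow : ∀ u, ∑ v, M u v = 1) (hlazy : ∀ u, (1 : ℝ) / 2 ≤ M u u)
    (p : Fin m → ℝ) (T : Finset (Fin m)) :
    ∑ v ∈ T, ∑ u, p u * M u v ≤
      (1 / 2) * (lsCurve p (T.card - 2 * ∑ u ∈ T, ∑ v ∈ Tᶜ, M u v) +
        lsCurve p (T.card + 2 * ∑ u ∈ T, ∑ v ∈ Tᶜ, M u v)) := by
  set a : Fin m → ℝ := fun u => ∑ v ∈ T, M u v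
  have hadd (u) : a u + ∑ v ∈ Tᶜ, M u v = 1 := (Finset.sum_add_sum_compl T _).trans (hrow u)
  have hcompl (u) : 0 ≤ ∑ v ∈ Tᶜ, M u v := Finset.sum_nonneg fun v _ => hnonneg u v
  have ha0 (u) : 0 ≤ a u := Finset.sum_nonneg fun v _ => hnonneg u v
  have hin (u) (hu : u ∈ T) : 1 / 2 ≤ a u :=
    (hlazy u).trans (Finset.single_le_sum (f := M u) (fun v _ => hnonneg u v) hu)
  have hout (u) (hu : u ∉ T) : a u ≤ 1 / 2 := by
    have := (hlazy u).trans (Finset.single_le_sum (f := M u) (fun v _ => hnonneg u v)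
      (Finset.mem_compl.2 hu))
    linarith [hadd u]
  have hsumT : ∑ u ∈ T, a u = T.card - ∑ u ∈ T, ∑ v ∈ Tᶜ, M u v := by
    rw [eq_sub_iff_add_eq, ← Finset.sum_add_distrib, Finset.sum_congr rfl fun u _ => hadd u]
    simp
  have hsumC : ∑ u ∈ Tᶜ, a u = ∑ u ∈ T, ∑ v ∈ Tᶜ, M u v :=
    Finset.sum_comm.trans <|
      Finset.sum_congr rfl fun u _ => Finset.sum_congr rfl fun v _ => hsymm v u
  have h1 := sum_mul_le_lsCurve p (fun u => if u ∈ T then 2 * a u - 1 else 0)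
    (fun u => by split_ifs with h; exacts [by linarith [hin u h], le_rfl])
    (fun u => by split_ifs with h <;> linarith [hadd u, hcompl u])
  have h2 := sum_mul_le_lsCurve p (fun u => if u ∈ T then 1 else 2 * a u)
    (fun u => by split_ifs with h <;> linarith [ha0 u])
    (fun u => by split_ifs with h; exacts [le_rfl, by linarith [hout u h]])
  have e1 : (∑ u, if u ∈ T then 2 * a u - 1 else 0) =
      T.card - 2 * ∑ u ∈ T, ∑ v ∈ Tᶜ, M u v := by
    rw [← Finset.sum_filter, Finset.filter_univ_mem, Finset.sum_sub_distrib, ← Finset.mul_sum,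
      hsumT, Finset.sum_const, nsmul_eq_mul]
    ring
  have e2 : (∑ u, if u ∈ T then 1 else 2 * a u) =
      T.card + 2 * ∑ u ∈ T, ∑ v ∈ Tᶜ, M u v := by
    rw [← Finset.sum_add_sum_compl T, Finset.sum_congr rfl fun u hu => if_pos hu,
      Finset.sum_congr rfl fun u hu => if_neg (Finset.mem_compl.1 hu), ← Finset.mul_sum, hsumC]
    simp
  rw [e1] at h1
  rw [e2] at h2
  have hmass : ∑ v ∈ T, ∑ u, p u * M u v = (1 / 2) *
      (∑ u, (if u ∈ T then 2 * a u - 1 else 0) * p u +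
        ∑ u, (if u ∈ T then 1 else 2 * a u) * p u) := by
    rw [Finset.sum_comm, ← Finset.sum_add_distrib, Finset.mul_sum]
    refine Finset.sum_congr rfl fun u _ => ?_
    rw [← Finset.mul_sum]
    change p u * a u = _
    split_ifs <;> ring
  rw [hmass]
  linarith

/-- Lovász–Simonovits: for a symmetric lazy Markov chain, the curve of the
`t`-step distribution is dominated by chords of the curve of the `(t-1)`-step distribution,
with offset governed by the conductance of the level set. -/
theorem lovasz_simonovits (m : ℕ) (M : Matrix (Fin m) (Fin m) ℝ)
    (hsymm : ∀ u v, M u v = M v u) (hnonneg : ∀ u v, 0 ≤ M u v)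
    (hrow : ∀ u, ∑ v, M u v = 1) (hlazy : ∀ u, (1 : ℝ) / 2 ≤ M u u)
    (s : Fin m) (t : ℕ) (ht : 1 ≤ t) (k : ℕ) (hk : k ≤ m) :
    lsCurve (fun v => (M ^ t) s v) (k : ℝ) ≤
      (1 / 2) *
        (lsCurve (fun v => (M ^ (t - 1)) s v)
            ((k : ℝ) - 2 * min (k : ℝ) ((m : ℝ) - k) *
              conduct M (levelSet (fun v => (M ^ t) s v) k)) +
          lsCurve (fun v => (M ^ (t - 1)) s v)
            ((k : ℝ) + 2 * min (k : ℝ) ((m : ℝ) - k) *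
              conduct M (levelSet (fun v => (M ^ t) s v) k))) := by
  have hstep : (fun v => (M ^ t) s v) = fun v => ∑ u, (M ^ (t - 1)) s u * M u v := by
    funext v
    rw [← Matrix.mul_apply, ← pow_succ, Nat.sub_add_cancel ht]
  set L := levelSet (fun v => (M ^ t) s v) k with hL
  have hcard : L.card = k := card_levelSet _ hk
  have hflow := min_mul_conduct M L
  have h := sum_vecMul_le_lsCurve M hsymm hnonneg hrow hlazy (fun v => (M ^ (t - 1)) s v) L
  rw [hcard] at hflow h
  rw [lsCurve_natCast, ← hL, mul_assoc, hflow]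
  exact (Finset.sum_congr rfl fun v _ => congrFun hstep v).trans_le h
end
end
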